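/- arXiv:2305.05560 — 2 statements merged into one kernel-verified Lean document; each statement's English description precedes it below -/
import Mathlib

section
/- There exist random vectors X and Y taking values in ℝ² and a strictly monotonically increasing, twice continuously differentiable function u : ℝ² → ℝ with ∂²u/∂x₁∂x₂ ≤ 0 everywhere, such that X strictly first-order stochastically dominates Y (F_X(v) ≤ F_Y(v) for all v, with strict inequality for some v) but E[u(X)] = E[u(Y)]. (For instance, X taking value (2,4) with probability 2/3 and (4,2) with probability 1/3, Y taking values (2,2), (2,4), (4,4) each with probability 1/3, and u(v₁,v₂) = v₁ + v₂.) -/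
open MeasureTheory
open scoped ProbabilityTheory ENNReal

/-- Joint CDF of a random vector `X : Ω → ℝ × ℝ`. -/
noncomputable def jointCDF2 {Ω : Type*} [MeasureSpace Ω] (X : Ω → ℝ × ℝ) (v : ℝ × ℝ) : ℝ :=
  (ℙ {ω | (X ω).1 ≤ v.1 ∧ (X ω).2 ≤ v.2}).toReal

/-- Marginal CDF of the first coordinate. -/
noncomputable def margFst {Ω : Type*} [MeasureSpace Ω] (X : Ω → ℝ × ℝ) (t : ℝ) : ℝ :=
  (ℙ {ω | (X ω).1 ≤ t}).toReal

/-- Marginal CDF of the second coordinate. -/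
noncomputable def margSnd {Ω : Type*} [MeasureSpace Ω] (X : Ω → ℝ × ℝ) (t : ℝ) : ℝ :=
  (ℙ {ω | (X ω).2 ≤ t}).toReal

/-- `x` Pareto dominates `y` in `ℝ²`. -/
def ParetoDom2 (x y : ℝ × ℝ) : Prop :=
  (y.1 ≤ x.1 ∧ y.2 ≤ x.2) ∧ (y.1 < x.1 ∨ y.2 < x.2)

/-- A strictly monotonically increasing function on `ℝ²`. -/
def StrictlyMonoIncr2 (u : ℝ × ℝ → ℝ) : Prop :=
  ∀ x y : ℝ × ℝ, ParetoDom2 x y → u y < u x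

/-- `X` first-order stochastically dominates `Y`. -/
def FSD2 {Ω : Type*} [MeasureSpace Ω] (X Y : Ω → ℝ × ℝ) : Prop :=
  ∀ v : ℝ × ℝ, jointCDF2 X v ≤ jointCDF2 Y v

/-- A univariate CDF `F` strictly first-order stochastically dominates `G`. -/
def StrictFSDcdf (F G : ℝ → ℝ) : Prop :=
  (∀ t, F t ≤ G t) ∧ ∃ t, F t < G t

/-- `X` distributionally dominates `Y`: joint FSD together with strict FSD of
some marginal. -/
def DistDom2 {Ω : Type*} [MeasureSpace Ω] (X Y : Ω → ℝ × ℝ) : Prop :=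
  FSD2 X Y ∧
    (StrictFSDcdf (margFst X) (margFst Y) ∨ StrictFSDcdf (margSnd X) (margSnd Y))

/-- The law of a fair coin. -/
noncomputable def fairCoin : Measure Bool :=
  (2⁻¹ : ℝ≥0∞) • Measure.dirac true + (2⁻¹ : ℝ≥0∞) • Measure.dirac false

instance isProbabilityMeasure_fairCoin : IsProbabilityMeasure fairCoin :=
  ⟨by simp [fairCoin, ENNReal.inv_two_add_inv_two]⟩

theorem fairCoin_toReal_setOf (p : Bool → Prop) [DecidablePred p] :
    (fairCoin {b | p b}).toReal =
      (if p true then 1 / 2 else 0) + (if p false then 1 / 2 else 0) := by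
  by_cases ht : p true <;> by_cases hf : p false <;>
    simp [fairCoin, ht, hf, ENNReal.inv_two_add_inv_two]
  norm_num

theorem integral_fairCoin (f : Bool → ℝ) :
    ∫ b, f b ∂fairCoin = (f true + f false) / 2 := by
  rw [integral_fintype (Integrable.of_finite)]
  simp [fairCoin, Measure.real]
  ring

/-- Strict first-order stochastic dominance does not imply strictly greater expected
utility even for strictly increasing, twice continuously differentiable utilities with
nonpositive mixed partial derivative. -/
theorem stmt10 :
    ∃ (Ω : Type) (_ : MeasureSpace Ω) (_ : IsProbabilityMeasure (ℙ : Measure Ω))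
      (X Y : Ω → ℝ × ℝ) (u : ℝ × ℝ → ℝ),
      Measurable X ∧ Measurable Y ∧
      ContDiff ℝ 2 u ∧ StrictlyMonoIncr2 u ∧
      (∀ a b : ℝ, deriv (fun x₁ => deriv (fun x₂ => u (x₁, x₂)) b) a ≤ 0) ∧
      (∀ v : ℝ × ℝ, jointCDF2 X v ≤ jointCDF2 Y v) ∧
      (∃ v : ℝ × ℝ, jointCDF2 X v < jointCDF2 Y v) ∧
      ∫ ω, u (X ω) ∂ℙ = ∫ ω, u (Y ω) ∂ℙ := by
  classical
  let m : MeasureSpace Bool := ⟨fairCoin⟩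
  have key : ∀ (Z : Bool → ℝ × ℝ) (v : ℝ × ℝ), jointCDF2 Z v =
      (if (Z true).1 ≤ v.1 ∧ (Z true).2 ≤ v.2 then 1 / 2 else 0) +
        (if (Z false).1 ≤ v.1 ∧ (Z false).2 ≤ v.2 then 1 / 2 else 0) :=
    fun Z v => fairCoin_toReal_setOf fun b => (Z b).1 ≤ v.1 ∧ (Z b).2 ≤ v.2
  refine ⟨Bool, m, isProbabilityMeasure_fairCoin,
    fun b => if b then (1, 0) else (0, 1), fun b => if b then (1, 1) else (0, 0),
    fun x => x.1 + x.2, measurable_of_finite _, measurable_of_finite _,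
    contDiff_fst.add contDiff_snd, ?_, ?_, ?_, ⟨(0, 0), ?_⟩, ?_⟩
  · rintro x y ⟨⟨h₁, h₂⟩, h | h⟩ <;> dsimp only <;> linarith
  · intro a b
    simp
  · intro v
    simp only [key, if_true, Bool.false_eq_true, if_false]
    split_ifs <;> grind
  · simp only [key]
    norm_num
  · refine (integral_fairCoin _).trans (Eq.trans ?_ (integral_fairCoin _).symm)
    norm_num
end

section
/- Let X and Y be random vectors taking values in ℝ^d each of whose coordinates are mutually independent, i.e. F_X(v) = Π_{i=1}^d F_{X_i}(v_i) and F_Y(v) = Π_{i=1}^d F_{Y_i}(v_i) for all v ∈ ℝ^d. Then X distributionally dominates Y if and only if X strictly first-order stochastically dominates Y. -/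
open MeasureTheory
open scoped ProbabilityTheory

/-- Joint CDF of a random vector `X : Ω → Fin d → ℝ`. -/
noncomputable def jointCDF {Ω : Type*} [MeasureSpace Ω] {d : ℕ}
    (X : Ω → Fin d → ℝ) (v : Fin d → ℝ) : ℝ :=
  (ℙ {ω | ∀ i, X ω i ≤ v i}).toReal

/-- Marginal CDF of coordinate `i` of a random vector. -/
noncomputable def margCDF {Ω : Type*} [MeasureSpace Ω] {d : ℕ}
    (X : Ω → Fin d → ℝ) (i : Fin d) (t : ℝ) : ℝ :=
  (ℙ {ω | X ω i ≤ t}).toReal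

/-- `x` Pareto dominates `y`. -/
def ParetoDom {d : ℕ} (x y : Fin d → ℝ) : Prop :=
  (∀ i, y i ≤ x i) ∧ ∃ i, y i < x i

/-- A strictly monotonically increasing function on `ℝ^d`. -/
def StrictlyMonoIncr {d : ℕ} (u : (Fin d → ℝ) → ℝ) : Prop :=
  ∀ x y : Fin d → ℝ, ParetoDom x y → u y < u x

/-- `X` first-order stochastically dominates `Y`. -/
def FSD {Ω : Type*} [MeasureSpace Ω] {d : ℕ} (X Y : Ω → Fin d → ℝ) : Prop :=
  ∀ v : Fin d → ℝ, jointCDF X v ≤ jointCDF Y v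

/-- The marginal `X_i` strictly first-order stochastically dominates `Y_i`. -/
def MargStrictFSD {Ω : Type*} [MeasureSpace Ω] {d : ℕ}
    (X Y : Ω → Fin d → ℝ) (i : Fin d) : Prop :=
  (∀ t : ℝ, margCDF X i t ≤ margCDF Y i t) ∧ ∃ t : ℝ, margCDF X i t < margCDF Y i t

/-- `X` distributionally dominates `Y`. -/
def DistDom {Ω : Type*} [MeasureSpace Ω] {d : ℕ} (X Y : Ω → Fin d → ℝ) : Prop :=
  FSD X Y ∧ ∃ i : Fin d, MargStrictFSD X Y i

/-- Sending all coordinates other than `i` to infinity in the joint CDF recovers the marginal. -/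
theorem tendsto_jointCDF_update {Ω : Type*} [MeasureSpace Ω]
    [IsProbabilityMeasure (ℙ : Measure Ω)] {d : ℕ} (X : Ω → Fin d → ℝ) (i : Fin d) (t : ℝ) :
    Filter.Tendsto (fun n : ℕ => jointCDF X (Function.update (fun _ => (n : ℝ)) i t))
      Filter.atTop (nhds (margCDF X i t)) := by
  have hmono : Monotone fun n : ℕ =>
      {ω | ∀ j, X ω j ≤ Function.update (fun _ => (n : ℝ)) i t j} := by
    intro m n hmn ω hω j
    refine (hω j).trans (update_le_update_iff.2 ⟨le_rfl, fun _ _ => ?_⟩ j)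
    exact_mod_cast hmn
  have hunion : ⋃ n : ℕ, {ω | ∀ j, X ω j ≤ Function.update (fun _ => (n : ℝ)) i t j}
      = {ω | X ω i ≤ t} := by
    ext ω
    simp only [Set.mem_iUnion, Set.mem_ofPred_eq]
    refine ⟨fun ⟨n, hn⟩ => by simpa using hn i, fun h => ?_⟩
    obtain ⟨M, hM⟩ := (Set.finite_range (X ω)).bddAbove
    obtain ⟨n, hn⟩ := exists_nat_ge M
    refine ⟨n, fun j => ?_⟩
    rcases eq_or_ne j i with rfl | hj
    · simpa using h
    · simpa [hj] using (hM ⟨j, rfl⟩).trans hn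
  have htend := tendsto_measure_iUnion_atTop (μ := (ℙ : Measure Ω)) hmono
  rw [hunion] at htend
  exact (ENNReal.tendsto_toReal (measure_ne_top _ _)).comp htend

/-- First-order stochastic dominance passes to the marginals. -/
theorem FSD.margCDF_le {Ω : Type*} [MeasureSpace Ω] [IsProbabilityMeasure (ℙ : Measure Ω)]
    {d : ℕ} {X Y : Ω → Fin d → ℝ} (h : FSD X Y) (i : Fin d) (t : ℝ) :
    margCDF X i t ≤ margCDF Y i t :=
  le_of_tendsto_of_tendsto' (tendsto_jointCDF_update X i t) (tendsto_jointCDF_update Y i t)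
    fun _ => h _

/-- For random vectors with mutually independent coordinates (joint CDFs factor as products
of marginal CDFs), distributional dominance is equivalent to strict first-order stochastic
dominance. -/
theorem stmt11 {Ω : Type*} [MeasureSpace Ω] [IsProbabilityMeasure (ℙ : Measure Ω)]
    {d : ℕ} (X Y : Ω → Fin d → ℝ)
    (hX : Measurable X) (hY : Measurable Y)
    (hXind : ∀ v : Fin d → ℝ, jointCDF X v = ∏ i, margCDF X i (v i))
    (hYind : ∀ v : Fin d → ℝ, jointCDF Y v = ∏ i, margCDF Y i (v i)) :
    DistDom X Y ↔
      (∀ v : Fin d → ℝ, jointCDF X v ≤ jointCDF Y v) ∧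
        ∃ v : Fin d → ℝ, jointCDF X v < jointCDF Y v := by
  constructor
  · rintro ⟨hF, i, -, t, ht⟩
    obtain ⟨n, hn⟩ := ((tendsto_jointCDF_update X i t).eventually_lt
      (tendsto_jointCDF_update Y i t) ht).exists
    exact ⟨hF, _, hn⟩
  · rintro ⟨hF, v, hv⟩
    refine ⟨hF, ?_⟩
    by_contra! hne
    refine hv.not_ge ?_
    rw [hXind, hYind]
    refine Finset.prod_le_prod (fun _ _ => ENNReal.toReal_nonneg) fun i _ => ?_
    by_contra! hlt
    exact hne i ⟨FSD.margCDF_le hF i, v i, hlt⟩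
end
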